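/- arXiv:1610.00900 — 2 statements merged into one kernel-verified Lean document; each statement's English description precedes it below -/
import Mathlib

section
/- Let C be a self-dual Z_2R linear code in Z_2^α × R^β with α > 0 and β > 0. If C is non-separable, then α ≥ 4 and β ≥ 2. -/
open Finset

namespace Z2R

abbrev Rng : Type := DualNumber (ZMod 2)
noncomputable instance : DecidableEq Rng := Classical.decEq _
def uu : Rng := DualNumber.eps
abbrev Amb (α β : ℕ) : Type := (Fin α → ZMod 2) × (Fin β → Rng)
def smulR {α β : ℕ} (d : Rng) (x : Amb α β) : Amb α β :=
  (fun i => d.fst * x.1 i, fun j => d * x.2 j)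
def IsCode {α β : ℕ} (C : Set (Amb α β)) : Prop :=
  (0 : Amb α β) ∈ C ∧ (∀ x ∈ C, ∀ y ∈ C, x + y ∈ C) ∧ ∀ (d : Rng), ∀ x ∈ C, smulR d x ∈ C
def inn {α β : ℕ} (v w : Amb α β) : Rng :=
  TrivSqZeroExt.inr (∑ i, v.1 i * w.1 i) + ∑ j, v.2 j * w.2 j
def dual {α β : ℕ} (C : Set (Amb α β)) : Set (Amb α β) :=
  {w | ∀ v ∈ C, inn v w = 0}
def IsSelfDual {α β : ℕ} (C : Set (Amb α β)) : Prop :=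
  IsCode C ∧ C = dual C
def wtH {n : ℕ} (v : Fin n → ZMod 2) : ℕ := (univ.filter fun i => v i ≠ 0).card
noncomputable def wtLr (r : Rng) : ℕ := if r = 0 then 0 else if r = uu then 2 else 1
noncomputable def wtL {α β : ℕ} (c : Amb α β) : ℕ := wtH c.1 + ∑ j, wtLr (c.2 j)
noncomputable def N {β : ℕ} (w : Fin β → Rng) : ℕ :=
  (univ.filter fun j => w j = 1 ∨ w j = 1 + uu).card
noncomputable def Nu {β : ℕ} (w : Fin β → Rng) : ℕ :=
  (univ.filter fun j => w j = uu).card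
noncomputable def Ns {β : ℕ} (w y : Fin β → Rng) : ℕ :=
  (univ.filter fun j => w j = y j ∧ (w j = 1 ∨ w j = 1 + uu)).card
noncomputable def Nd {β : ℕ} (w y : Fin β → Rng) : ℕ :=
  (univ.filter fun j => (w j = 1 ∧ y j = 1 + uu) ∨ (w j = 1 + uu ∧ y j = 1)).card
noncomputable def N11 {β : ℕ} (w y : Fin β → Rng) : ℕ :=
  (univ.filter fun j => (w j = 1 ∨ w j = 1 + uu) ∧ (y j = 1 ∨ y j = 1 + uu)).card
def CX {α β : ℕ} (C : Set (Amb α β)) : Set (Fin α → ZMod 2) := Prod.fst '' C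
def CY {α β : ℕ} (C : Set (Amb α β)) : Set (Fin β → Rng) := Prod.snd '' C
def Separable {α β : ℕ} (C : Set (Amb α β)) : Prop := C = (CX C) ×ˢ (CY C)
def Cb {α β : ℕ} (C : Set (Amb α β)) : Set (Amb α β) :=
  {c ∈ C | ∀ j, c.2 j = 0 ∨ c.2 j = uu}
def lincomb {α β k : ℕ} (g : Fin k → Amb α β) : Set (Amb α β) :=
  {z | ∃ a : Fin k → Rng, z = ∑ i, smulR (a i) (g i)}
noncomputable def theta (r : Rng) : ZMod 4 :=
  if r = 0 then 0 else if r = 1 then 1 else if r = uu then 2 else 3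

theorem IsSelfDual.inn_eq_zero {α β : ℕ} {C : Set (Amb α β)} (hC : IsSelfDual C)
    {v w : Amb α β} (hv : v ∈ C) (hw : w ∈ C) : inn v w = 0 := by
  rw [hC.2] at hw
  exact hw v hv

theorem IsSelfDual.mem_of_inn {α β : ℕ} {C : Set (Amb α β)} (hC : IsSelfDual C)
    {w : Amb α β} (h : ∀ v ∈ C, inn v w = 0) : w ∈ C := by
  rw [hC.2]
  exact h

theorem amb_add_self {α β : ℕ} (v : Amb α β) : v + v = 0 := by
  ext <;> exact CharTwo.add_self_eq_zero _

/-- A code that contains `(x, 0)` for each of its words `(x, y)` is separable. -/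
theorem separable_of_fst_mem {α β : ℕ} {C : Set (Amb α β)} (hC : IsCode C)
    (h : ∀ v ∈ C, (v.1, 0) ∈ C) : Separable C := by
  refine Set.Subset.antisymm (fun v hv => ⟨⟨v, hv, rfl⟩, ⟨v, hv, rfl⟩⟩) ?_
  rintro ⟨x, y⟩ ⟨⟨v, hv, hx⟩, ⟨w, hw, hy⟩⟩
  obtain rfl : v.1 = x := hx
  obtain rfl : w.2 = y := hy
  have key := hC.2.1 _ (h v hv) _ (hC.2.1 _ (h w hw) w hw)
  have hw1 : w.1 + w.1 = 0 := congrArg Prod.fst (amb_add_self w)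
  have e : ((v.1, 0) : Amb α β) + ((w.1, 0) + w) = (v.1, w.2) :=
    Prod.ext (by simp [hw1]) (by simp)
  rwa [e] at key

/-- A code that contains `(0, y)` for each of its words `(x, y)` is separable. -/
theorem separable_of_snd_mem {α β : ℕ} {C : Set (Amb α β)} (hC : IsCode C)
    (h : ∀ v ∈ C, (0, v.2) ∈ C) : Separable C := by
  refine separable_of_fst_mem hC fun v hv => ?_
  have key := hC.2.1 _ hv _ (h v hv)
  have hv2 : v.2 + v.2 = 0 := congrArg Prod.snd (amb_add_self v)
  have e : v + ((0, v.2) : Amb α β) = (v.1, 0) := Prod.ext (by simp) (by simp [hv2])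
  rwa [e] at key

theorem zmod_two_mul_self (a : ZMod 2) : a * a = a := by
  revert a; decide

theorem IsSelfDual.sum_fst_eq_zero {α β : ℕ} {C : Set (Amb α β)} (hC : IsSelfDual C)
    {v : Amb α β} (hv : v ∈ C) : ∑ i, v.1 i = 0 := by
  have h := congrArg TrivSqZeroExt.snd (hC.inn_eq_zero hv hv)
  have hs : ∀ r : Rng, (r * r).snd = 0 := fun r => by
    simp [TrivSqZeroExt.snd_mul, mul_comm, CharTwo.add_self_eq_zero]
  simpa [inn, TrivSqZeroExt.snd_sum, hs, zmod_two_mul_self, -TrivSqZeroExt.snd_mul] using h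

theorem IsSelfDual.sum_snd_fst_eq_zero {α β : ℕ} {C : Set (Amb α β)} (hC : IsSelfDual C)
    {v : Amb α β} (hv : v ∈ C) : ∑ j, (v.2 j).fst = 0 := by
  have h := congrArg TrivSqZeroExt.fst (hC.inn_eq_zero hv hv)
  simpa [inn, TrivSqZeroExt.fst_sum, zmod_two_mul_self] using h

theorem IsSelfDual.one_zero_mem {α β : ℕ} {C : Set (Amb α β)} (hC : IsSelfDual C) :
    ((1, 0) : Amb α β) ∈ C :=
  hC.mem_of_inn fun v hv => by simp [inn, hC.sum_fst_eq_zero hv]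

theorem IsSelfDual.even_left {α β : ℕ} {C : Set (Amb α β)} (hC : IsSelfDual C) : Even α := by
  have h := hC.sum_fst_eq_zero hC.one_zero_mem
  rw [← ZMod.natCast_eq_zero_iff_even]
  simpa using h

theorem IsSelfDual.separable_of_left_eq_two {β : ℕ} {C : Set (Amb 2 β)} (hC : IsSelfDual C) :
    Separable C := by
  refine separable_of_fst_mem hC.1 fun v hv => ?_
  have h := hC.sum_fst_eq_zero hv
  have hv1 : ∀ x : Fin 2 → ZMod 2, ∑ i, x i = 0 → x = 0 ∨ x = 1 := by decide
  rcases hv1 _ h with h | h <;> rw [h]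
  · exact hC.1.1
  · exact hC.one_zero_mem

theorem IsSelfDual.separable_of_right_eq_one {α : ℕ} {C : Set (Amb α 1)} (hC : IsSelfDual C) :
    Separable C := by
  refine separable_of_snd_mem hC.1 fun v hv => hC.mem_of_inn fun w hw => ?_
  have hv2 : (v.2 0).fst = 0 := by simpa using hC.sum_snd_fst_eq_zero hv
  have hw2 : (w.2 0).fst = 0 := by simpa using hC.sum_snd_fst_eq_zero hw
  ext <;> simp [inn, hv2, hw2]

-- STATEMENT 10
theorem stmt10 {α β : ℕ} (hα : 0 < α) (hβ : 0 < β) (C : Set (Amb α β)) (hC : IsSelfDual C)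
    (hns : ¬ Separable C) : 4 ≤ α ∧ 2 ≤ β := by
  have heven := hC.even_left
  have hα2 : α ≠ 2 := by
    rintro rfl
    exact hns hC.separable_of_left_eq_two
  have hβ1 : β ≠ 1 := by
    rintro rfl
    exact hns hC.separable_of_right_eq_one
  obtain ⟨k, rfl⟩ := heven
  omega

end Z2R
end

section
/- Let C ⊆ Z_2^α × R^β be a Z_2R linear code with α > 0 and β > 0 such that (1,…,1 | 0,…,0) ∈ C and (0,…,0 | u,…,u) ∈ C, the set of Lee weights of nonzero codewords of C has exactly two elements, and α = 2β. Then the set {u·c : c ∈ C} has at most 2 elements (i.e. the parameter δ of C satisfies δ ≤ 1). -/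
open Finset

namespace Z2R

lemma uu_ne_zero : uu ≠ 0 := fun h => by
  have := congrArg TrivSqZeroExt.snd h
  simp [uu] at this

lemma uu_mul_eq (r : Rng) : uu * r = 0 ∨ uu * r = uu := by
  have h : ∀ a : ZMod 2, a = 0 ∨ a = 1 := by decide
  rcases h r.fst with hr | hr
  · left
    ext <;> simp [uu, hr]
  · right
    ext <;> simp [uu, hr]

lemma wtLr_zero : wtLr 0 = 0 := by simp [wtLr]

lemma wtLr_uu : wtLr uu = 2 := by simp [wtLr, uu_ne_zero]

lemma wtLr_le_two (r : Rng) : wtLr r ≤ 2 := by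
  unfold wtLr
  split_ifs <;> omega

lemma wtH_zero {n : ℕ} : wtH (fun _ : Fin n => (0 : ZMod 2)) = 0 := by simp [wtH]

lemma wtH_one {n : ℕ} : wtH (fun _ : Fin n => (1 : ZMod 2)) = n := by simp [wtH]

lemma wtL_one_zero {α β : ℕ} : wtL ((fun _ => 1, fun _ => 0) : Amb α β) = α := by
  simp [wtL, wtH_one, wtLr_zero]

lemma wtL_zero_uu {α β : ℕ} : wtL ((fun _ => 0, fun _ => uu) : Amb α β) = 2 * β := by
  simp [wtL, wtH_zero, wtLr_uu, mul_comm]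

lemma wtL_one_uu {α β : ℕ} : wtL ((fun _ => 1, fun _ => uu) : Amb α β) = α + 2 * β := by
  simp [wtL, wtH_one, wtLr_uu, mul_comm]

lemma smulR_uu {α β : ℕ} (c : Amb α β) : smulR uu c = (fun _ => 0, fun j => uu * c.2 j) := by
  simp [smulR, uu]

/-- A multiple of `u` whose Lee weight is at least `2 * β` is the word `(0 | u, …, u)`. -/
lemma smulR_uu_eq_of_le_wtL {α β : ℕ} {c : Amb α β} (h : 2 * β ≤ wtL (smulR uu c)) :
    smulR uu c = (fun _ => 0, fun _ => uu) := by
  rw [smulR_uu] at h ⊢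
  simp only [wtL, wtH_zero, zero_add] at h
  have hle : ∀ j ∈ univ, wtLr (uu * c.2 j) ≤ 2 := fun j _ => wtLr_le_two _
  have hsum : ∑ j, wtLr (uu * c.2 j) = ∑ _j : Fin β, 2 := by
    refine le_antisymm (sum_le_sum hle) ?_
    simpa [mul_comm] using h
  have heq := (sum_eq_sum_iff_of_le hle).1 hsum
  refine Prod.ext rfl (funext fun j => (uu_mul_eq (c.2 j)).resolve_left fun h0 => ?_)
  have := heq j (mem_univ j)
  rw [h0, wtLr_zero] at this
  omega

-- STATEMENT 18
theorem stmt18 {α β : ℕ} (hα : 0 < α) (hβ : 0 < β) (C : Set (Amb α β)) (hcode : IsCode C)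
    (h1 : ((fun _ => 1, fun _ => 0) : Amb α β) ∈ C)
    (h2 : ((fun _ => 0, fun _ => uu) : Amb α β) ∈ C)
    (htw : (wtL '' (C \ {0})).ncard = 2) (hab : α = 2 * β) :
    Nat.card ((fun c => smulR uu c) '' C) ≤ 2 := by
  have wt0 : wtL (0 : Amb α β) = 0 := by simp [wtL, wtH, wtLr]
  have mem : ∀ c ∈ C, wtL c ≠ 0 → wtL c ∈ wtL '' (C \ {0}) := fun c hc hw =>
    ⟨c, ⟨hc, fun h => hw (by rw [Set.mem_singleton_iff.1 h, wt0])⟩, rfl⟩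
  have h3 : ((fun _ => 1, fun _ => uu) : Amb α β) ∈ C := by
    convert hcode.2.1 _ h1 _ h2 using 1
    ext <;> simp
  have hsub : ({2 * β, 4 * β} : Set ℕ) ⊆ wtL '' (C \ {0}) := by
    rintro _ (rfl | rfl)
    · rw [← wtL_zero_uu (α := α)]
      exact mem _ h2 (by rw [wtL_zero_uu]; omega)
    · have hw : wtL ((fun _ => 1, fun _ => uu) : Amb α β) = 4 * β := by
        rw [wtL_one_uu]; omega
      rw [← hw]
      exact mem _ h3 (by omega)
  have hS : ({2 * β, 4 * β} : Set ℕ) = wtL '' (C \ {0}) := by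
    refine Set.eq_of_subset_of_ncard_le hsub ?_ (Set.finite_of_ncard_ne_zero (by omega))
    rw [htw, Set.ncard_pair (by omega)]
  have himg : (fun c => smulR uu c) '' C ⊆ {0, (fun _ => 0, fun _ => uu)} := by
    rintro _ ⟨c, hc, rfl⟩
    by_cases h0 : smulR uu c = 0
    · exact Or.inl h0
    · refine Or.inr (smulR_uu_eq_of_le_wtL ?_)
      have hw : wtL (smulR uu c) ∈ ({2 * β, 4 * β} : Set ℕ) :=
        hS ▸ ⟨_, ⟨hcode.2.2 uu c hc, h0⟩, rfl⟩
      rcases hw with hw | hw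
      · exact hw.ge
      · rw [Set.mem_singleton_iff.1 hw]
        omega
  rw [Nat.card_coe_set_eq]
  refine (Set.ncard_le_ncard himg (Set.toFinite _)).trans ((Set.ncard_insert_le _ _).trans ?_)
  rw [Set.ncard_singleton]

end Z2R
end
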